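/- arXiv:math/0607004 — 2 statements merged into one kernel-verified Lean document; each statement's English description precedes it below -/
import Mathlib

section
/- Let D be a nonempty connected open subset of ℂ^n and H a group acting on D such that for each h ∈ H the map x ↦ h·x is a biholomorphic bijection of D, and assume the action of H on D is transitive. Let 𝓥 be a Hilbert space of holomorphic functions on D on which H acts unitarily by translations (τ_h f)(x) = f(h⁻¹·x), and assume 𝓥 ≠ {0}. Then every continuous ℂ-linear map A : 𝓥 → 𝓥 commuting with τ_h for every h ∈ H is a scalar multiple of the identity; in particular, 𝓥 is an irreducible unitary representation of H. -/
open scoped ComplexInnerProductSpace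

open Metric Filter Topology

lemma aux_weak {E : Type*} [NormedAddCommGroup E] [NormedSpace ℂ E] [CompleteSpace E]
    (Φ : ℂ → E →L[ℂ] ℂ) (U : Set ℂ) (hU : IsOpen U)
    (h : ∀ f, DifferentiableOn ℂ (fun z => Φ z f) U) : DifferentiableOn ℂ Φ U := by
  intro c hc
  obtain ⟨R, hR, hRU⟩ := Metric.nhds_basis_closedBall.mem_iff.1 (hU.mem_nhds hc)
  obtain ⟨C, hC⟩ := banach_steinhaus (g := fun z : closedBall c R => Φ z) (by
    intro f
    obtain ⟨C, hC⟩ := (isCompact_closedBall c R).exists_bound_of_continuousOn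
      (((h f).mono hRU).continuousOn)
    exact ⟨C, fun i => hC i i.2⟩)
  have hB : ∀ z ∈ closedBall c R, ∀ f, ‖Φ z f‖ ≤ C * ‖f‖ := fun z hz f =>
    (Φ z).le_of_opNorm_le (hC ⟨z, hz⟩) f
  have hdiff : ∀ f, DifferentiableAt ℂ (fun z => Φ z f) c := fun f =>
    (h f).differentiableAt (hU.mem_nhds hc)
  have hder : ∀ f, ‖deriv (fun z => Φ z f) c‖ ≤ C / R * ‖f‖ := by
    intro f
    have := Complex.norm_deriv_le_of_forall_mem_sphere_norm_le (c := c) hR (f := fun z => Φ z f)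
      (C := C * ‖f‖) ?_ (fun z hz => hB z (sphere_subset_closedBall hz) f)
    · calc _ ≤ _ := this
        _ = _ := by ring
    · apply DifferentiableOn.diffContOnCl
      exact (h f).mono (closure_ball_subset_closedBall.trans hRU)
  let L : E →L[ℂ] ℂ := LinearMap.mkContinuous
    { toFun := fun f => deriv (fun z => Φ z f) c
      map_add' := by
        intro f g
        simp only [map_add]
        exact deriv_fun_add (hdiff f) (hdiff g)
      map_smul' := by
        intro a f
        simp only [map_smul, RingHom.id_apply, smul_eq_mul]
        exact deriv_const_mul a (hdiff f) } (C / R) hder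
  have hL : ∀ f, L f = deriv (fun z => Φ z f) c := fun f => rfl
  have hC0 : 0 ≤ C := (norm_nonneg _).trans (hC ⟨c, mem_closedBall_self hR.le⟩)
  have key : ∀ z ∈ ball c R, ‖Φ z - Φ c - (z - c) • L‖ ≤ 3 * C / R ^ 2 * ‖z - c‖ ^ 2 := by
    intro z hz
    refine ContinuousLinearMap.opNorm_le_bound _ (by positivity) fun f => ?_
    have := Complex.dist_le_mul_div_pow_of_mapsTo_ball_of_isLittleO
      (f := fun w => Φ w f - (w - c) * L f) (c := c) (z := z) (R₁ := R) (R₂ := 3 * C * ‖f‖)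
      (n := 1) ?_ ?_ ?_ hz
    · simp only [dist_eq_norm, sub_self, zero_mul, sub_zero] at this
      calc ‖(Φ z - Φ c - (z - c) • L) f‖ = ‖Φ z f - (z - c) * L f - Φ c f‖ := by
            simp only [ContinuousLinearMap.sub_apply, ContinuousLinearMap.smul_apply, smul_eq_mul]
            congr 1; ring
        _ ≤ _ := this
        _ = _ := by rw [div_pow]; norm_num; ring
    · refine ((h f).mono (ball_subset_closedBall.trans hRU)).sub ?_
      fun_prop
    · intro w hw
      have h1 := hB w (ball_subset_closedBall hw) f
      have h2 := hB c (mem_closedBall_self hR.le) f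
      have h3 : ‖(w - c) * L f‖ ≤ C * ‖f‖ := by
        rw [norm_mul]
        calc _ ≤ R * (C / R * ‖f‖) := by
              apply mul_le_mul _ (hder f) (norm_nonneg _) hR.le
              exact (mem_ball_iff_norm.1 hw).le
          _ = _ := by field_simp
      rw [mem_closedBall, dist_eq_norm]
      simp only [sub_self, zero_mul, sub_zero]
      calc _ ≤ ‖Φ w f - (w - c) * L f‖ + ‖Φ c f‖ := norm_sub_le _ _
        _ ≤ ‖Φ w f‖ + ‖(w - c) * L f‖ + ‖Φ c f‖ := by gcongr; exact norm_sub_le _ _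
        _ ≤ _ := by linarith
    · have h1 := (hdiff f).hasDerivAt.isLittleO
      rw [← hL f] at h1
      simp only [pow_one, sub_self, zero_mul, sub_zero]
      refine (h1.norm_right).congr_left fun w => ?_
      simp only [smul_eq_mul]
      ring
  have : HasDerivAt Φ L c := by
    rw [hasDerivAt_iff_isLittleO]
    refine Asymptotics.IsBigO.trans_isLittleO (g := fun z => ‖z - c‖ ^ 2) ?_ ?_
    · refine Asymptotics.IsBigO.of_bound (3 * C / R ^ 2) ?_
      filter_upwards [ball_mem_nhds c hR] with z hz
      simpa using key z hz
    · have h0 : Tendsto (fun z : ℂ => z - c) (𝓝 c) (𝓝 0) := by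
        have : Continuous fun z : ℂ => z - c := by fun_prop
        simpa using this.tendsto c
      exact (Asymptotics.isLittleO_norm_pow_id (one_lt_two)).comp_tendsto h0
  exact this.differentiableAt.differentiableWithinAt

lemma aux_real (f : ℂ → ℂ) (r : ℝ) (hf : DifferentiableOn ℂ f (ball 0 r))
    (h0 : ∀ t : ℝ, |t| < r → f t = 0) : ∀ z ∈ ball (0 : ℂ) r, f z = 0 := by
  intro z hz
  have hr : 0 < r := pos_of_mem_ball hz
  refine (hf.analyticOnNhd isOpen_ball).eqOn_zero_of_preconnected_of_frequently_eq_zero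
    (convex_ball 0 r).isPreconnected (mem_ball_self hr) ?_ hz
  have ht : Tendsto (fun t : ℝ => (t : ℂ)) (𝓝[≠] 0) (𝓝[≠] 0) := by
    refine tendsto_nhdsWithin_iff.2 ⟨?_, ?_⟩
    · have := Complex.continuous_ofReal.tendsto 0
      simp only [Complex.ofReal_zero] at this
      exact this.mono_left nhdsWithin_le_nhds
    · filter_upwards [self_mem_nhdsWithin] with t ht
      simpa using ht
  refine ht.frequently (Eventually.frequently ?_)
  filter_upwards [nhdsWithin_le_nhds (ball_mem_nhds (0 : ℝ) hr)] with t ht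
  exact h0 t (by simpa using ht)

lemma aux_polar {E : Type*} [NormedAddCommGroup E] [NormedSpace ℂ E]
    (Φ : ℂ → E) (Ψ : ℂ → E →L[ℂ] ℂ) (r : ℝ)
    (hΦ : DifferentiableOn ℂ Φ (ball 0 r)) (hΨ : DifferentiableOn ℂ Ψ (ball 0 r))
    (h0 : ∀ z ∈ ball (0 : ℂ) r, Ψ ((starRingEnd ℂ) z) (Φ z) = 0) :
    ∀ z ∈ ball (0 : ℂ) r, Ψ 0 (Φ z) = 0 := by
  have hin : ∀ a b : ℂ, a ∈ ball (0 : ℂ) (r / 2) → b ∈ ball (0 : ℂ) (r / 2) →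
      a + Complex.I * b ∈ ball (0 : ℂ) r ∧ a - Complex.I * b ∈ ball (0 : ℂ) r := by
    intro a b ha hb
    rw [mem_ball_zero_iff] at *
    rw [mem_ball_zero_iff]
    have e : ‖Complex.I * b‖ = ‖b‖ := by simp
    exact ⟨(norm_add_le _ _).trans_lt (by linarith), (norm_sub_le _ _).trans_lt (by linarith)⟩
  have s1 : ∀ b : ℝ, |b| < r / 2 → ∀ a ∈ ball (0 : ℂ) (r / 2),
      Ψ (a - Complex.I * b) (Φ (a + Complex.I * b)) = 0 := by
    intro b hb
    have hb' : (b : ℂ) ∈ ball (0 : ℂ) (r / 2) := by simpa using hb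
    refine aux_real _ _ ?_ ?_
    · exact (hΨ.comp (by fun_prop) fun a ha => (hin a b ha hb').2).clm_apply
        (hΦ.comp (by fun_prop) fun a ha => (hin a b ha hb').1)
    · intro a ha
      have := h0 (a + Complex.I * b) (hin a b (by simpa using ha) hb').1
      simpa [sub_eq_add_neg] using this
  have s2 : ∀ a ∈ ball (0 : ℂ) (r / 2), ∀ b ∈ ball (0 : ℂ) (r / 2),
      Ψ (a - Complex.I * b) (Φ (a + Complex.I * b)) = 0 := by
    intro a ha
    refine aux_real _ _ ?_ ?_
    · exact (hΨ.comp (by fun_prop) fun b hb => (hin a b ha hb).2).clm_apply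
        (hΦ.comp (by fun_prop) fun b hb => (hin a b ha hb).1)
    · intro b hb
      exact s1 b hb a ha
  intro z hz
  rw [mem_ball_zero_iff] at hz
  have := s2 (z / 2) (by rw [mem_ball_zero_iff]; simp; linarith)
    (-Complex.I * z / 2) (by rw [mem_ball_zero_iff]; simp; linarith)
  have e : Complex.I * (-Complex.I * z / 2) = z / 2 := by
    linear_combination (-z / 2) * Complex.I_mul_I
  rw [e] at this
  simpa using this

lemma aux_ident {F : Type*} [NormedAddCommGroup F] [NormedSpace ℂ F] (D : Set F)
    (hD : IsOpen D) (hc : IsPreconnected D) (f : F → ℂ) (hf : DifferentiableOn ℂ f D)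
    (x₀ : F) (hx₀ : x₀ ∈ D) (h0 : ∀ᶠ x in 𝓝 x₀, f x = 0) : ∀ x ∈ D, f x = 0 := by
  have hsub : D ⊆ {x | ∀ᶠ y in 𝓝 x, f y = 0} := by
    refine hc.subset_of_closure_inter_subset isOpen_setOf_eventually_nhds ⟨x₀, hx₀, h0⟩ ?_
    rintro x ⟨hx, hxD⟩
    obtain ⟨ρ, hρ, hb⟩ := Metric.isOpen_iff.1 hD x hxD
    obtain ⟨p, hp, hpx⟩ := Metric.mem_closure_iff.1 hx ρ hρ
    have hpb : p ∈ ball x ρ := by rwa [mem_ball, dist_comm]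
    show ∀ᶠ y in 𝓝 x, f y = 0
    filter_upwards [ball_mem_nhds x hρ] with q hq
    let l : ℂ → F := fun t => p + t • (q - p)
    have hl : Differentiable ℂ l := by fun_prop
    have hopen : IsOpen (l ⁻¹' ball x ρ) := isOpen_ball.preimage hl.continuous
    have hconv : Convex ℝ (l ⁻¹' ball x ρ) := by
      intro s hs t ht a b ha hb hab
      have := (convex_ball x ρ) hs ht ha hb hab
      have e : l (a • s + b • t) = a • l s + b • l t := by
        have : p = a • p + b • p := by rw [← add_smul, hab, one_smul]
        simp only [l, smul_add, add_smul, smul_assoc]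
        nth_rewrite 1 [this]
        abel
      show l _ ∈ ball x ρ
      rwa [e]
    have l0 : l 0 = p := by simp [l]
    have l1 : l 1 = q := by simp [l]
    have hfl : DifferentiableOn ℂ (fun t => f (l t)) (l ⁻¹' ball x ρ) :=
      hf.comp hl.differentiableOn fun t ht => hb ht
    have hz : (fun t => f (l t)) =ᶠ[𝓝 0] 0 := by
      have : Tendsto l (𝓝 0) (𝓝 p) := by simpa [l0] using hl.continuous.tendsto 0
      exact this.eventually hp
    have := (hfl.analyticOnNhd hopen).eqOn_zero_of_preconnected_of_eventuallyEq_zero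
      hconv.isPreconnected (show (0 : ℂ) ∈ _ by simpa [l0] using hpb) hz
      (show (1 : ℂ) ∈ _ by simpa [l1] using hq)
    simpa [l1] using this
  intro x hx
  exact (hsub hx).self_of_nhds

/-- **Propagation of irreducibility (S. Kobayashi).** If the group `H` acts transitively
and biholomorphically on a nonempty connected open set `D ⊆ ℂⁿ`, and `𝓥 ≠ {0}` is a
Hilbert space of holomorphic functions on `D` on which `H` acts unitarily by
translations, then every continuous intertwiner of `𝓥` is a scalar multiple of the
identity; in particular `𝓥` is an irreducible unitary representation of `H`. -/
theorem irreducible_of_transitive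
    {n : ℕ} (D : Set (EuclideanSpace ℂ (Fin n)))
    (hD_open : IsOpen D) (hD_conn : IsConnected D)
    {H : Type*} [Group H] [MulAction H (EuclideanSpace ℂ (Fin n))]
    (hact_maps : ∀ h : H, Set.MapsTo (fun x => h • x) D D)
    (hact_hol : ∀ h : H, DifferentiableOn ℂ (fun x => h • x) D)
    (htrans : ∀ x ∈ D, ∀ y ∈ D, ∃ h : H, h • x = y)
    {𝓥 : Type*} [NormedAddCommGroup 𝓥] [InnerProductSpace ℂ 𝓥] [CompleteSpace 𝓥]
    (T : 𝓥 →ₗ[ℂ] (EuclideanSpace ℂ (Fin n) → ℂ))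
    (hT_inj : ∀ f g : 𝓥, (∀ x ∈ D, T f x = T g x) → f = g)
    (hT_hol : ∀ f : 𝓥, DifferentiableOn ℂ (T f) D)
    (hT_eval : ∀ y ∈ D, Continuous fun f : 𝓥 => T f y)
    (τ : H → 𝓥 →ₗ[ℂ] 𝓥)
    (hτ_eval : ∀ (h : H) (f : 𝓥), ∀ x ∈ D, T (τ h f) x = T f (h⁻¹ • x))
    (hτ_unitary : ∀ (h : H) (f g : 𝓥), ⟪τ h f, τ h g⟫ = ⟪f, g⟫)
    (hτ_surj : ∀ h : H, Function.Surjective (τ h))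
    (hne : ∃ f : 𝓥, f ≠ 0)
    (A : 𝓥 →L[ℂ] 𝓥)
    (hA : ∀ (h : H) (f : 𝓥), A (τ h f) = τ h (A f)) :
    ∃ c : ℂ, ∀ f : 𝓥, A f = c • f := by
  obtain ⟨x₀, hx₀⟩ := hD_conn.nonempty
  have hK : ∀ y, ∃ k : 𝓥, y ∈ D → ∀ f, ⟪k, f⟫ = T f y := by
    intro y
    by_cases hy : y ∈ D
    · let ev : StrongDual ℂ 𝓥 :=
        { toFun := fun f => T f y
          map_add' := by intro f g; simp
          map_smul' := by intro c f; simp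
          cont := hT_eval y hy }
      refine ⟨(InnerProductSpace.toDual ℂ 𝓥).symm ev, fun _ f => ?_⟩
      rw [InnerProductSpace.toDual_symm_apply]
      rfl
    · exact ⟨0, fun h => absurd h hy⟩
  choose K hK using hK
  have hτK : ∀ (h : H), ∀ y ∈ D, τ h (K y) = K (h • y) := by
    intro h y hy
    refine ext_inner_right ℂ fun f => ?_
    obtain ⟨g, rfl⟩ := hτ_surj h f
    rw [hτ_unitary, hK y hy, hK _ (hact_maps h hy), hτ_eval h g _ (hact_maps h hy),
      inv_smul_smul]
  have hdiagK : ∀ y ∈ D, ⟪K y, K y⟫ = ⟪K x₀, K x₀⟫ := by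
    intro y hy
    obtain ⟨h, rfl⟩ := htrans x₀ hx₀ y hy
    rw [← hτK h x₀ hx₀, hτ_unitary]
  have hdiagA : ∀ y ∈ D, ⟪K y, A (K y)⟫ = ⟪K x₀, A (K x₀)⟫ := by
    intro y hy
    obtain ⟨h, rfl⟩ := htrans x₀ hx₀ y hy
    rw [← hτK h x₀ hx₀, hA, hτ_unitary]
  have hk0 : ⟪K x₀, K x₀⟫ ≠ 0 := by
    intro h0
    obtain ⟨f, hf⟩ := hne
    apply hf
    apply hT_inj
    intro x hx
    have : K x = 0 := by
      rw [← inner_self_eq_zero (𝕜 := ℂ), hdiagK x hx, h0]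
    rw [← hK x hx, this]
    simp
  let c : ℂ := ⟪K x₀, A (K x₀)⟫ / ⟪K x₀, K x₀⟫
  let B : 𝓥 →L[ℂ] 𝓥 := A - c • ContinuousLinearMap.id ℂ 𝓥
  have hB : ∀ f, B f = A f - c • f := fun f => rfl
  have hdiag : ∀ y ∈ D, ⟪K y, B (K y)⟫ = 0 := by
    intro y hy
    rw [hB, inner_sub_right, inner_smul_right, hdiagA y hy, hdiagK y hy]
    simp only [c]
    rw [div_mul_cancel₀ _ hk0, sub_self]
  have hloc : ∀ a ∈ D, ∀ᶠ x in 𝓝 a, ⟪K x, B (K a)⟫ = 0 := by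
    intro a ha
    obtain ⟨ρ, hρ, hball⟩ := Metric.isOpen_iff.1 hD_open a ha
    filter_upwards [ball_mem_nhds a hρ] with x hx
    let v := x - a
    have hv : ‖v‖ < ρ := mem_ball_iff_norm.1 hx
    let r : ℝ := 2 * ρ / (ρ + ‖v‖)
    have hpos : 0 < ρ + ‖v‖ := by positivity
    have hr1 : 1 < r := by rw [lt_div_iff₀ hpos]; linarith
    have hin : ∀ z ∈ ball (0 : ℂ) r, a + z • v ∈ D := by
      intro z hz
      apply hball
      rw [mem_ball_iff_norm, add_sub_cancel_left, norm_smul]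
      rw [mem_ball_zero_iff] at hz
      calc ‖z‖ * ‖v‖ ≤ r * ‖v‖ := by gcongr
        _ < ρ := by
          rw [div_mul_eq_mul_div, div_lt_iff₀ hpos]
          nlinarith
    have hline : ∀ f, DifferentiableOn ℂ (fun z : ℂ => T f (a + z • v)) (ball 0 r) := fun f =>
      (hT_hol f).comp (by fun_prop) hin
    have hconj : ∀ z ∈ ball (0 : ℂ) r, (starRingEnd ℂ) z ∈ ball (0 : ℂ) r := by
      intro z hz
      simpa using hz
    have hP := aux_polar (E := StrongDual ℂ 𝓥) (fun z => (innerSL ℂ (K (a + z • v))).comp B)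
      (fun w => NormedSpace.inclusionInDoubleDual ℂ 𝓥 (K (a + (starRingEnd ℂ) w • v))) r ?_ ?_ ?_ 1
      (by simpa using hr1)
    · simpa [v] using hP
    · refine aux_weak _ _ isOpen_ball fun f => (hline (B f)).congr fun z hz => ?_
      exact hK _ (hin z hz) (B f)
    · refine aux_weak _ _ isOpen_ball fun l => ?_
      obtain ⟨f, rfl⟩ := (InnerProductSpace.toDual ℂ 𝓥).surjective l
      have : DifferentiableOn ℂ
          (fun w => (starRingEnd ℂ) (T f (a + (starRingEnd ℂ) w • v))) (ball 0 r) := by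
        intro w hw
        apply DifferentiableAt.differentiableWithinAt
        have h1 := (hline f).differentiableAt (isOpen_ball.mem_nhds (hconj w hw))
        have h2 := h1.hasDerivAt.conj_conj
        simpa [Function.comp_def] using h2.differentiableAt
      refine this.congr fun w hw => ?_
      rw [← hK _ (hin _ (hconj w hw)) f, inner_conj_symm]
      rfl
    · intro z hz
      have := hdiag _ (hin z hz)
      simpa using this
  have hBK : ∀ a ∈ D, ∀ x ∈ D, ⟪K x, B (K a)⟫ = 0 := by
    intro a ha x hx
    rw [hK x hx]
    refine aux_ident D hD_open hD_conn.isPreconnected _ (hT_hol _) a ha ?_ x hx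
    filter_upwards [hloc a ha, hD_open.mem_nhds ha] with y hy hyD
    rw [← hK y hyD, hy]
  refine ⟨c, fun f => ?_⟩
  rw [← sub_eq_zero, ← hB]
  apply hT_inj
  intro x hx
  have hadj : ContinuousLinearMap.adjoint B (K x) = 0 := by
    apply hT_inj
    intro y hy
    rw [← hK y hy, ContinuousLinearMap.adjoint_inner_right, ← inner_conj_symm, hBK y hy x hx]
    simp
  rw [← hK x hx, ← ContinuousLinearMap.adjoint_inner_left, hadj]
  simp
end

section
/- Let D be a nonempty connected open subset of ℂ^n and let 𝓥₁, 𝓥₂ be Hilbert spaces of ℂ-valued functions on D with continuous point evaluations whose members are all holomorphic on D, with reproducing kernels K₁, K₂ respectively. If K₁(x, x) = K₂(x, x) for every x ∈ D, then K₁(x, y) = K₂(x, y) for all x, y ∈ D; consequently 𝓥₁ and 𝓥₂ coincide as subsets of the holomorphic functions on D and their inner products agree. -/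
open scoped ComplexInnerProductSpace

section Helpers

open Set Filter Topology Metric

/-- Weak holomorphy implies strong holomorphy (operators into `ℂ`). -/
lemma weak_hol {E : Type*} [NormedAddCommGroup E] [NormedSpace ℂ E] [CompleteSpace E]
    {U : Set ℂ} (hU : IsOpen U) (B : ℂ → E →L[ℂ] ℂ)
    (hB : ∀ f, DifferentiableOn ℂ (fun s => B s f) U) {z : ℂ} (hz : z ∈ U) :
    DifferentiableAt ℂ B z := by
  obtain ⟨r, hr, hrU⟩ := Metric.nhds_basis_closedBall.mem_iff.1 (hU.mem_nhds hz)
  let ι := {p : ℂ × ℂ // p.1 ∈ closedBall z r ∧ p.2 ∈ closedBall z r ∧ p.1 ≠ z ∧ p.2 ≠ z ∧ p.1 ≠ p.2}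
  have key : ∃ C', ∀ i : ι, ‖(i.1.1 - i.1.2)⁻¹ • (slope B z i.1.1 - slope B z i.1.2)‖ ≤ C' := by
    apply banach_steinhaus
    intro f
    have hd : DifferentiableOn ℂ (dslope (fun s => B s f) z) U :=
      (Complex.differentiableOn_dslope (hU.mem_nhds hz)).2 (hB f)
    have hdd : ContinuousOn (deriv (dslope (fun s => B s f) z)) (closedBall z r) :=
      ((hd.deriv hU).continuousOn).mono hrU
    obtain ⟨C, hC⟩ := (isCompact_closedBall z r).exists_bound_of_continuousOn hdd
    refine ⟨C, ?_⟩
    rintro ⟨⟨p, q⟩, hp, hq, hpz, hqz, hpq⟩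
    simp only at hp hq hpz hqz hpq
    have h1 := Convex.norm_image_sub_le_of_norm_deriv_le
      (fun x hx => hd.differentiableAt (hU.mem_nhds (hrU hx))) hC (convex_closedBall z r) hq hp
    rw [dslope_of_ne _ hpz, dslope_of_ne _ hqz] at h1
    have h2 : ((p - q)⁻¹ • (slope B z p - slope B z q)) f
        = (p - q)⁻¹ * (slope (fun s => B s f) z p - slope (fun s => B s f) z q) := by
      simp [slope_def_module]
    simp only
    rw [h2, norm_mul, norm_inv]
    have h3 : 0 < ‖p - q‖ := norm_pos_iff.2 (sub_ne_zero.2 hpq)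
    rw [inv_mul_le_iff₀ h3, mul_comm]
    exact h1
  obtain ⟨C, hC⟩ := key
  have hlip : LipschitzOnWith (Real.toNNReal C) (slope B z) (closedBall z r \ {z}) := by
    apply LipschitzOnWith.of_dist_le_mul
    intro p hp q hq
    by_cases hpq : p = q
    · simp [hpq]
    have h1 := hC ⟨(p, q), hp.1, hq.1, hp.2, hq.2, hpq⟩
    have h3 : 0 < ‖p - q‖ := norm_pos_iff.2 (sub_ne_zero.2 hpq)
    simp only [norm_smul, norm_inv] at h1
    rw [inv_mul_le_iff₀ h3] at h1
    rw [dist_eq_norm, dist_eq_norm, mul_comm]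
    refine h1.trans ?_
    gcongr
    exact Real.le_coe_toNNReal C
  have hmem : closedBall z r \ {z} ∈ 𝓝[≠] z :=
    sdiff_mem_nhdsWithin_compl (closedBall_mem_nhds z hr) _
  have hcau : Cauchy (map (slope B z) (𝓝[≠] z)) := by
    refine Cauchy.map_of_le ?_ hlip.uniformContinuousOn (le_principal_iff.2 hmem)
    exact cauchy_nhds.mono nhdsWithin_le_nhds
  obtain ⟨d, hd⟩ := CompleteSpace.complete hcau
  exact (hasDerivAt_iff_tendsto_slope.2 hd).differentiableAt

lemma conj_diff {E F : Type*} [NormedAddCommGroup E] [NormedSpace ℂ E]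
    [NormedAddCommGroup F] [NormedSpace ℂ F]
    (J : E →L⋆[ℂ] F) (B : ℂ → E) {t : ℂ} (hB : DifferentiableAt ℂ B (starRingEnd ℂ t)) :
    DifferentiableAt ℂ (fun t => J (B (starRingEnd ℂ t))) t := by
  have h := hasDerivAt_iff_tendsto_slope.1 hB.hasDerivAt
  have hc : Tendsto (starRingEnd ℂ) (𝓝[≠] t) (𝓝[≠] (starRingEnd ℂ t)) := by
    refine tendsto_nhdsWithin_iff.2 ⟨?_, ?_⟩
    · exact (Complex.continuous_conj.tendsto t).mono_left nhdsWithin_le_nhds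
    · filter_upwards [self_mem_nhdsWithin] with x hx
      exact fun h => hx ((starRingEnd ℂ).injective h)
  have h2 := (J.continuous.tendsto _).comp (h.comp hc)
  refine (hasDerivAt_iff_tendsto_slope.2 (h2.congr fun x => ?_)).differentiableAt
  simp [slope_def_module]

/-- One-variable identity principle from the real points. -/
lemma real_zero {f : ℂ → ℂ} (hf : DifferentiableOn ℂ f (ball 0 2))
    (h0 : ∀ x : ℝ, (x : ℂ) ∈ ball (0 : ℂ) 2 → f x = 0) : ∀ z ∈ ball (0 : ℂ) 2, f z = 0 := by
  have ha := hf.analyticOnNhd isOpen_ball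
  refine ha.eqOn_zero_of_preconnected_of_frequently_eq_zero (z₀ := 0)
    (convex_ball (0 : ℂ) 2).isPreconnected (by simp) ?_
  have h1 : Tendsto (fun x : ℝ => (x : ℂ)) (𝓝[≠] 0) (𝓝[≠] (0 : ℂ)) := by
    refine tendsto_nhdsWithin_iff.2 ⟨?_, ?_⟩
    · exact (Complex.continuous_ofReal.tendsto' 0 0 (by simp)).mono_left nhdsWithin_le_nhds
    · filter_upwards [self_mem_nhdsWithin] with x hx
      simpa using hx
  refine h1.frequently (Eventually.frequently ?_)
  have : ∀ᶠ x : ℝ in 𝓝 0, (x : ℂ) ∈ ball (0 : ℂ) 2 :=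
    (Complex.continuous_ofReal.tendsto' 0 0 (by simp)).eventually (ball_mem_nhds _ (by norm_num))
  filter_upwards [this.filter_mono nhdsWithin_le_nhds] with x hx
  exact h0 x hx

/-- Identity principle in several variables. -/
lemma ident {E : Type*} [NormedAddCommGroup E] [NormedSpace ℂ E] {D : Set E}
    (hD : IsOpen D) (hc : IsPreconnected D) {f : E → ℂ} (hf : DifferentiableOn ℂ f D)
    {a : E} (ha : a ∈ D) (h0 : ∀ᶠ x in 𝓝 a, f x = 0) : ∀ x ∈ D, f x = 0 := by
  have hsub : D ⊆ {x | ∀ᶠ y in 𝓝 x, f y = 0} := by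
    refine hc.subset_of_closure_inter_subset isOpen_setOf_eventually_nhds ⟨a, ha, h0⟩ ?_
    rintro x ⟨hx, hxD⟩
    obtain ⟨r, hr, hrD⟩ := Metric.isOpen_iff.1 hD x hxD
    obtain ⟨z, hzB, hz⟩ := mem_closure_iff_nhds.1 hx _ (ball_mem_nhds x hr)
    refine Filter.mem_of_superset (ball_mem_nhds x hr) fun w hw => ?_
    let L : ℂ → E := fun t => z + t • (w - z)
    have hLd : Differentiable ℂ L := by fun_prop
    have hLc := hLd.continuous
    have hconv : Convex ℝ (L ⁻¹' ball x r) := by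
      intro s hs t ht p q hp hq hpq
      have : L (p • s + q • t) = p • L s + q • L t := by
        have e : z = p • z + q • z := by rw [← add_smul, hpq, one_smul]
        simp only [L]
        simp only [add_smul, smul_add, smul_assoc]
        nth_rewrite 1 [e]
        abel
      rw [mem_preimage, this]
      exact convex_ball x r hs ht hp hq hpq
    have hg : DifferentiableOn ℂ (f ∘ L) (L ⁻¹' ball x r) :=
      (hf.mono hrD).comp hLd.differentiableOn fun _ h => h
    have hga := hg.analyticOnNhd (isOpen_ball.preimage hLc)
    have h := hga.eqOn_zero_of_preconnected_of_eventuallyEq_zero (z₀ := 0) hconv.isPreconnected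
      (by simpa [L] using hzB) ((hLc.tendsto' 0 z (by simp [L])).eventually hz)
    have := h (x := 1) (by simpa [L] using hw)
    simpa [L] using this
  exact fun x hx => (hsub hx).self_of_nhds

/-- Sesqui-kernel along a complex line is jointly holomorphic. -/
lemma joint {V : Type*} [NormedAddCommGroup V] [InnerProductSpace ℂ V] [CompleteSpace V]
    (κ : ℂ → V) {R : ℝ} (hκ : ∀ f : V, DifferentiableOn ℂ (fun s => ⟪κ s, f⟫) (ball 0 R))
    (σ τ : ℂ → ℂ) {u : ℂ} (hσ : DifferentiableAt ℂ σ u) (hτ : DifferentiableAt ℂ τ u)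
    (hσu : σ u ∈ ball (0 : ℂ) R) (hτu : τ u ∈ ball (0 : ℂ) R) :
    DifferentiableAt ℂ (fun u => ⟪κ (σ u), κ (starRingEnd ℂ (τ u))⟫) u := by
  let B : ℂ → V →L[ℂ] ℂ := fun s => innerSL ℂ (κ s)
  have hB : ∀ z ∈ ball (0 : ℂ) R, DifferentiableAt ℂ B z := fun z hz =>
    weak_hol isOpen_ball B (by simpa [B] using hκ) hz
  let J : (V →L[ℂ] ℂ) →L⋆[ℂ] V :=
    ((InnerProductSpace.toDual ℂ V).symm.toContinuousLinearEquiv : (V →L[ℂ] ℂ) →L⋆[ℂ] V)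
  have hJ : ∀ s, J (B s) = κ s := fun s => by
    have : B s = InnerProductSpace.toDual ℂ V (κ s) := by
      ext f; simp [B]
    rw [this]
    exact (InnerProductSpace.toDual ℂ V).symm_apply_apply (κ s)
  have hψ : DifferentiableAt ℂ (fun t => J (B (starRingEnd ℂ t))) (τ u) :=
    conj_diff J B (hB _ (by simpa using hτu))
  have h1 : DifferentiableAt ℂ (fun u => B (σ u)) u := (hB _ hσu).comp u hσ
  have h2 : DifferentiableAt ℂ (fun u => J (B (starRingEnd ℂ (τ u)))) u := hψ.comp u hτ
  have h3 := h1.clm_apply h2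
  simp only [hJ] at h3
  simpa [B] using h3

lemma line_zero {V W : Type*} [NormedAddCommGroup V] [InnerProductSpace ℂ V] [CompleteSpace V]
    [NormedAddCommGroup W] [InnerProductSpace ℂ W] [CompleteSpace W]
    (κ : ℂ → V) (hκ : ∀ f : V, DifferentiableOn ℂ (fun s => ⟪κ s, f⟫) (ball 0 4))
    (μ : ℂ → W) (hμ : ∀ f : W, DifferentiableOn ℂ (fun s => ⟪μ s, f⟫) (ball 0 4))
    (hd : ∀ s ∈ ball (0 : ℂ) 4, ⟪κ s, κ s⟫ = ⟪μ s, μ s⟫) : ⟪κ 1, κ 0⟫ = ⟪μ 1, μ 0⟫ := by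
  have hp : ∀ u ∈ ball (0 : ℂ) 2, ∀ w ∈ ball (0 : ℂ) 2, u + Complex.I * w ∈ ball (0 : ℂ) 4 := by
    intro u hu w hw
    rw [mem_ball_zero_iff] at *
    have := norm_add_le u (Complex.I * w)
    simp at this
    linarith
  have hm : ∀ u ∈ ball (0 : ℂ) 2, ∀ w ∈ ball (0 : ℂ) 2, u - Complex.I * w ∈ ball (0 : ℂ) 4 := by
    intro u hu w hw
    rw [mem_ball_zero_iff] at *
    have := norm_sub_le u (Complex.I * w)
    simp at this
    linarith
  let H : ℂ → ℂ → ℂ := fun u w =>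
    ⟪κ (u + Complex.I * w), κ (starRingEnd ℂ (u - Complex.I * w))⟫ -
    ⟪μ (u + Complex.I * w), μ (starRingEnd ℂ (u - Complex.I * w))⟫
  have hH1 : ∀ w ∈ ball (0 : ℂ) 2, DifferentiableOn ℂ (fun u => H u w) (ball 0 2) := by
    intro w hw u hu
    exact ((joint κ hκ (fun u => u + Complex.I * w) (fun u => u - Complex.I * w) (by fun_prop)
      (by fun_prop) (hp u hu w hw) (hm u hu w hw)).sub
      (joint μ hμ (fun u => u + Complex.I * w) (fun u => u - Complex.I * w) (by fun_prop)
      (by fun_prop) (hp u hu w hw) (hm u hu w hw))).differentiableWithinAt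
  have hH2 : ∀ u ∈ ball (0 : ℂ) 2, DifferentiableOn ℂ (fun w => H u w) (ball 0 2) := by
    intro u hu w hw
    exact ((joint κ hκ (fun w => u + Complex.I * w) (fun w => u - Complex.I * w) (by fun_prop)
      (by fun_prop) (hp u hu w hw) (hm u hu w hw)).sub
      (joint μ hμ (fun w => u + Complex.I * w) (fun w => u - Complex.I * w) (by fun_prop)
      (by fun_prop) (hp u hu w hw) (hm u hu w hw))).differentiableWithinAt
  have h0 : ∀ u ∈ ball (0 : ℂ) 2, ∀ w ∈ ball (0 : ℂ) 2, H u w = 0 := by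
    intro u hu
    refine real_zero (hH2 u hu) fun y hy => ?_
    refine real_zero (hH1 y hy) (fun x hx => ?_) u hu
    have e : starRingEnd ℂ ((x : ℂ) - Complex.I * y) = x + Complex.I * y := by
      simp
    simp only [H, e]
    rw [hd _ (hp _ hx _ hy), sub_self]
  have := h0 (1/2) (by simp; norm_num) (-Complex.I/2) (by simp; norm_num)
  have e1 : (1/2 : ℂ) + Complex.I * (-Complex.I/2) = 1 := by
    linear_combination (-1/2 : ℂ) * Complex.I_mul_I
  have e2 : (1/2 : ℂ) - Complex.I * (-Complex.I/2) = 0 := by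
    linear_combination (1/2 : ℂ) * Complex.I_mul_I
  simp only [H, e1, e2, map_zero] at this
  exact sub_eq_zero.1 this

lemma transfer {X V W : Type*} [NormedAddCommGroup V] [InnerProductSpace ℂ V] [CompleteSpace V]
    [NormedAddCommGroup W] [InnerProductSpace ℂ W] [CompleteSpace W] (D : Set X)
    (k₁ : X → V) (k₂ : X → W)
    (hinj : ∀ f : V, (∀ x ∈ D, ⟪k₁ x, f⟫ = 0) → f = 0)
    (hk : ∀ x ∈ D, ∀ y ∈ D, ⟪k₁ x, k₁ y⟫ = ⟪k₂ x, k₂ y⟫) (f : V) :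
    ∃ f' : W, (∀ x ∈ D, ⟪k₁ x, f⟫ = ⟪k₂ x, f'⟫) ∧
      ∀ (g : V) (g' : W), (∀ x ∈ D, ⟪k₁ x, g⟫ = ⟪k₂ x, g'⟫) → ⟪f, g⟫ = ⟪f', g'⟫ := by
  let S : Submodule ℂ (V × W) := Submodule.span ℂ ((fun x => (k₁ x, k₂ x)) '' D)
  let Γ := S.topologicalClosure
  have hb : ∀ x ∈ D, (k₁ x, k₂ x) ∈ Γ := fun x hx =>
    S.le_topologicalClosure (Submodule.subset_span ⟨x, hx, rfl⟩)
  have hΓ : ∀ (g : V) (g' : W), (∀ x ∈ D, ⟪k₁ x, g⟫ = ⟪k₂ x, g'⟫) →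
      ∀ p ∈ Γ, ⟪p.1, g⟫ = ⟪p.2, g'⟫ := by
    intro g g' hg p hp
    have hcl : IsClosed {p : V × W | ⟪p.1, g⟫ = ⟪p.2, g'⟫} :=
      isClosed_eq (by fun_prop) (by fun_prop)
    refine closure_minimal (s := (S : Set (V × W))) ?_ hcl hp
    intro q hq
    induction hq using Submodule.span_induction with
    | mem x h => obtain ⟨y, hy, rfl⟩ := h; exact hg y hy
    | zero => simp
    | add x y _ _ hx hy =>
      simp only [mem_setOf_eq] at *
      simp [inner_add_left, hx, hy]
    | smul c x _ hx =>
      simp only [mem_setOf_eq] at *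
      simp [inner_smul_left, hx]
  have hΓ0 : ∀ p ∈ Γ, ∀ x ∈ D, ⟪k₁ x, p.1⟫ = ⟪k₂ x, p.2⟫ := by
    intro p hp x hx
    have := hΓ (k₁ x) (k₂ x) (fun y hy => hk y hy x hx) p hp
    rw [← inner_conj_symm, this, inner_conj_symm]
  have hnorm : ∀ p ∈ Γ, ‖p.1‖ = ‖p.2‖ := by
    intro p hp
    have := hΓ p.1 p.2 (hΓ0 p hp) p hp
    rw [inner_self_eq_norm_sq_to_K, inner_self_eq_norm_sq_to_K] at this
    have h2 : ‖p.1‖ ^ 2 = ‖p.2‖ ^ 2 := by exact_mod_cast this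
    exact (sq_eq_sq₀ (norm_nonneg _) (norm_nonneg _)).1 h2
  let P : Γ →L[ℂ] V := (ContinuousLinearMap.fst ℂ V W).comp Γ.subtypeL
  have hP : Isometry P := by
    refine AddMonoidHomClass.isometry_of_norm P fun p => ?_
    have := hnorm p.1 p.2
    change ‖p.1.1‖ = ‖p.1‖
    rw [Prod.norm_def, ← this, max_self]
  haveI : CompleteSpace Γ := S.isClosed_topologicalClosure.completeSpace_coe
  have hcl : IsClosed (P.range : Set V) := by
    exact hP.isClosedEmbedding.isClosed_range
  have htop : P.range = ⊤ := by
    rw [← hcl.submodule_topologicalClosure_eq, Submodule.topologicalClosure_eq_top_iff,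
      Submodule.eq_bot_iff]
    intro v hv
    refine hinj v fun x hx => ?_
    exact (Submodule.mem_orthogonal _ _).1 hv (k₁ x) ⟨⟨_, hb x hx⟩, rfl⟩
  have hf : f ∈ P.range := htop ▸ Submodule.mem_top
  obtain ⟨p, rfl⟩ := hf
  exact ⟨p.1.2, hΓ0 p.1 p.2, fun g g' h => hΓ g g' h p.1 p.2⟩

end Helpers

/-- **A space of holomorphic functions is determined by the restriction of its kernel to
the diagonal.** Let `D ⊆ ℂⁿ` be a nonempty connected open set and `𝓥₁`, `𝓥₂` Hilbert
spaces of holomorphic functions on `D` with continuous point evaluations and reproducing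
elements `k₁ y`, `k₂ y` for `y ∈ D` (so the kernels are `Kᵢ x y = Tᵢ (kᵢ y) x`,
characterized by `⟪kᵢ y, f⟫ = Tᵢ f y`, Mathlib's inner product being conjugate-linear in
the first slot).  If `K₁(x,x) = K₂(x,x)` for all `x ∈ D`, then `K₁ = K₂` on `D × D`;
consequently `𝓥₁` and `𝓥₂` coincide as spaces of holomorphic functions on `D` and their
inner products agree. -/
theorem rkhs_eq_of_kernel_eq_on_diagonal
    {n : ℕ} (D : Set (EuclideanSpace ℂ (Fin n)))
    (hD_open : IsOpen D) (hD_conn : IsConnected D)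
    {𝓥₁ : Type*} [NormedAddCommGroup 𝓥₁] [InnerProductSpace ℂ 𝓥₁] [CompleteSpace 𝓥₁]
    {𝓥₂ : Type*} [NormedAddCommGroup 𝓥₂] [InnerProductSpace ℂ 𝓥₂] [CompleteSpace 𝓥₂]
    (T₁ : 𝓥₁ →ₗ[ℂ] (EuclideanSpace ℂ (Fin n) → ℂ))
    (T₂ : 𝓥₂ →ₗ[ℂ] (EuclideanSpace ℂ (Fin n) → ℂ))
    (hT₁_inj : ∀ f g : 𝓥₁, (∀ x ∈ D, T₁ f x = T₁ g x) → f = g)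
    (hT₂_inj : ∀ f g : 𝓥₂, (∀ x ∈ D, T₂ f x = T₂ g x) → f = g)
    (hT₁_hol : ∀ f : 𝓥₁, DifferentiableOn ℂ (T₁ f) D)
    (hT₂_hol : ∀ f : 𝓥₂, DifferentiableOn ℂ (T₂ f) D)
    (hT₁_eval : ∀ y ∈ D, Continuous fun f : 𝓥₁ => T₁ f y)
    (hT₂_eval : ∀ y ∈ D, Continuous fun f : 𝓥₂ => T₂ f y)
    (k₁ : EuclideanSpace ℂ (Fin n) → 𝓥₁)
    (hk₁ : ∀ y ∈ D, ∀ f : 𝓥₁, ⟪k₁ y, f⟫ = T₁ f y)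
    (k₂ : EuclideanSpace ℂ (Fin n) → 𝓥₂)
    (hk₂ : ∀ y ∈ D, ∀ f : 𝓥₂, ⟪k₂ y, f⟫ = T₂ f y)
    (h_diag : ∀ x ∈ D, T₁ (k₁ x) x = T₂ (k₂ x) x) :
    (∀ x ∈ D, ∀ y ∈ D, T₁ (k₁ y) x = T₂ (k₂ y) x) ∧
    (∀ f₁ : 𝓥₁, ∃ f₂ : 𝓥₂, ∀ x ∈ D, T₁ f₁ x = T₂ f₂ x) ∧
    (∀ f₂ : 𝓥₂, ∃ f₁ : 𝓥₁, ∀ x ∈ D, T₁ f₁ x = T₂ f₂ x) ∧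
    (∀ (f g : 𝓥₁) (f' g' : 𝓥₂),
      (∀ x ∈ D, T₁ f x = T₂ f' x) → (∀ x ∈ D, T₁ g x = T₂ g' x) →
      ⟪f, g⟫ = ⟪f', g'⟫) := by
  have hker : ∀ x ∈ D, ∀ y ∈ D, T₁ (k₁ y) x = T₂ (k₂ y) x := by
    intro x hx a ha
    rw [← sub_eq_zero]
    refine ident hD_open hD_conn.isPreconnected (f := fun x => T₁ (k₁ a) x - T₂ (k₂ a) x)
      ((hT₁_hol _).sub (hT₂_hol _)) ha ?_ x hx
    obtain ⟨r, hr, hrD⟩ := Metric.isOpen_iff.1 hD_open a ha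
    filter_upwards [Metric.ball_mem_nhds a (show 0 < r / 4 by positivity)] with z hz
    have hzr : ‖z - a‖ < r / 4 := by rwa [← dist_eq_norm]
    let L : ℂ → EuclideanSpace ℂ (Fin n) := fun s => a + s • (z - a)
    have hL : ∀ s ∈ Metric.ball (0 : ℂ) 4, L s ∈ D := by
      intro s hs
      apply hrD
      rw [mem_ball_zero_iff] at hs
      simp only [L, Metric.mem_ball, dist_eq_norm, add_sub_cancel_left, norm_smul]
      nlinarith [norm_nonneg s, norm_nonneg (z - a)]
    have hLd : Differentiable ℂ L := by fun_prop
    have h := line_zero (fun s => k₁ (L s))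
      (fun f => (((hT₁_hol f).comp hLd.differentiableOn hL).congr
        fun s hs => hk₁ _ (hL s hs) f))
      (fun s => k₂ (L s))
      (fun f => (((hT₂_hol f).comp hLd.differentiableOn hL).congr
        fun s hs => hk₂ _ (hL s hs) f))
      (fun s hs => by
        rw [hk₁ _ (hL s hs), hk₂ _ (hL s hs)]
        exact h_diag _ (hL s hs))
    have h1 := hL 1 (by simp)
    rw [hk₁ _ h1, hk₂ _ h1] at h
    simp only [L, zero_smul, add_zero, one_smul, add_sub_cancel] at h
    rw [h, sub_self]
  have hi1 : ∀ f : 𝓥₁, (∀ x ∈ D, ⟪k₁ x, f⟫ = 0) → f = 0 := fun f hf =>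
    hT₁_inj f 0 fun x hx => by rw [← hk₁ x hx, hf x hx, map_zero]; rfl
  have hi2 : ∀ f : 𝓥₂, (∀ x ∈ D, ⟪k₂ x, f⟫ = 0) → f = 0 := fun f hf =>
    hT₂_inj f 0 fun x hx => by rw [← hk₂ x hx, hf x hx, map_zero]; rfl
  have hkk : ∀ x ∈ D, ∀ y ∈ D, ⟪k₁ x, k₁ y⟫ = ⟪k₂ x, k₂ y⟫ := fun x hx y hy => by
    rw [hk₁ x hx, hk₂ x hx, hker x hx y hy]
  refine ⟨hker, fun f₁ => ?_, fun f₂ => ?_, fun f g f' g' hf hg => ?_⟩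
  · obtain ⟨f₂, h, -⟩ := transfer D k₁ k₂ hi1 hkk f₁
    exact ⟨f₂, fun x hx => by rw [← hk₁ x hx, ← hk₂ x hx, h x hx]⟩
  · obtain ⟨f₁, h, -⟩ := transfer D k₂ k₁ hi2 (fun x hx y hy => (hkk x hx y hy).symm) f₂
    exact ⟨f₁, fun x hx => by rw [← hk₁ x hx, ← hk₂ x hx, h x hx]⟩
  · obtain ⟨f'', h, h'⟩ := transfer D k₁ k₂ hi1 hkk f
    have e : f'' = f' := hT₂_inj _ _ fun x hx => by
      rw [← hf x hx, ← hk₁ x hx, ← hk₂ x hx, h x hx]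
    rw [← e]
    exact h' g g' fun x hx => by rw [hk₁ x hx, hk₂ x hx, hg x hx]
end
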